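/- Consider Algorithm 1 run on an n-vertex graph G with maximum degree Δ. Call a vertex v bad (with respect to π and L) if E_{x⃗}[B(v) | π, L] > Δ^{1.4}, and let 𝓑 denote the set of bad vertices. Then E_{π,L}[ |𝓑| ] ≤ C·n·Δ^{−0.25} for a universal constant C. -/

import Mathlib

open Finset
open scoped Classical

section Defs

private lemma sym2_exists_mem {V : Type*} (e : Sym2 V) : ∃ a, a ∈ e :=
  ⟨(Quot.out e).1, Sym2.out_fst_mem e⟩

variable {V : Type*} [Fintype V] [DecidableEq V]

/-- The greedy maximal matching of the graph with edge set `E`, processing edges in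
increasing order of the priority function `ρ`: repeatedly pick the minimum-priority
remaining edge, add it to the matching, and discard all edges meeting it. -/
noncomputable def greedyMM {β : Type*} [LinearOrder β] (ρ : Sym2 V → β) (E : Finset (Sym2 V)) :
    Finset (Sym2 V) :=
  if h : E.Nonempty then
    insert (Classical.choose (E.exists_min_image ρ h))
      (greedyMM ρ (E.filter fun f =>
        ¬ ∃ v, v ∈ Classical.choose (E.exists_min_image ρ h) ∧ v ∈ f))
  else ∅
termination_by E.card
decreasing_by
  have he : Classical.choose (E.exists_min_image ρ h) ∈ E :=
    (Classical.choose_spec (E.exists_min_image ρ h)).1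
  apply Finset.card_lt_card
  refine (Finset.ssubset_iff_of_subset (Finset.filter_subset _ _)).2 ⟨_, he, ?_⟩
  intro hmem
  obtain ⟨a, ha⟩ := sym2_exists_mem (Classical.choose (E.exists_min_image ρ h))
  exact (Finset.mem_filter.1 hmem).2 ⟨a, ha, ha⟩

/-- The set of vertices matched by a set `M` of edges. -/
noncomputable def matchedV (M : Finset (Sym2 V)) : Finset V :=
  Finset.univ.filter fun v => ∃ e ∈ M, v ∈ e

/-- Residual degree of `v` with respect to the matching `M` in the graph with edge set `E`:
`0` if `v` is matched, and otherwise the degree of `v` in the induced subgraph on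
unmatched vertices. -/
noncomputable def resDeg (E M : Finset (Sym2 V)) (v : V) : ℕ :=
  if v ∈ matchedV M then 0
  else (E.filter fun e => v ∈ e ∧ ∀ w ∈ e, w ∉ matchedV M).card

/-- The number of vertices whose match-status differs between `M` and `M'`. -/
noncomputable def statusDiff (M M' : Finset (Sym2 V)) : ℕ :=
  (Finset.univ.filter fun v => ¬ (v ∈ matchedV M ↔ v ∈ matchedV M')).card


/-- The endpoints of an edge, as a finset. -/
noncomputable def ends (e : Sym2 V) : Finset V := Finset.univ.filter (· ∈ e)

/-- The recursive edge oracle (with bookkeeping), for the graph with (sampled) edge set `L`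
and priorities `π`, run with the partition-indicator vector `x`.
`eoQ π L x fuel e` returns a triple `(ans, qs, cnt)` where `ans` tells whether `e` joins the
greedy matching of the induced subgraph of `L` on `{v | x v}`, `qs` is the set of entries of
`x` queried, and `cnt` is the number of (recursive) oracle calls made on edges of `L` having
both endpoints in `{v | x v}` (including the call on `e` itself, when applicable).
The oracle first queries the two endpoints of `e` and answers NO if one of them is outside
the part; otherwise it recursively evaluates the incident edges of `L` of smaller priority,
in increasing order of priority, stopping as soon as one of them answers YES.
It is always invoked with `fuel = π e + 1`, which guarantees the fuel never runs out. -/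
noncomputable def eoQ (π : Sym2 V → ℕ) (L : Finset (Sym2 V)) (x : V → Bool) :
    ℕ → Sym2 V → Bool × Finset V × ℕ
  | 0, e => (false, ends e, 0)
  | fuel + 1, e =>
    if ∀ v ∈ e, x v then
      let nbrs := ((L.filter fun f => f ≠ e ∧ (∃ v, v ∈ e ∧ v ∈ f) ∧ π f < π e).toList.mergeSort
          (fun a b => decide (π a ≤ π b)))
      let r := nbrs.foldl (fun (s : Bool × Finset V × ℕ) f =>
          if s.1 then s
          else
            let t := eoQ π L x fuel f
            (t.1, s.2.1 ∪ t.2.1, s.2.2 + t.2.2)) (false, ∅, 0)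
      (!r.1, ends e ∪ r.2.1, (if e ∈ L then 1 else 0) + r.2.2)
    else (false, ends e, 0)

/-- Whether `e` belongs to the greedy matching, as decided by the edge oracle. -/
noncomputable def edgeOracle (π : Sym2 V → ℕ) (L : Finset (Sym2 V)) (x : V → Bool)
    (e : Sym2 V) : Bool × Finset V × ℕ :=
  eoQ π L x (π e + 1) e

/-- The degree oracle for vertex `v`: determines `Z_{v,1}`, the number of neighbors of `v`
(in the graph with edge set `Ed`) lying in the part `{u | x u}` that are unmatched in the
greedy matching of the induced subgraph of `L`.  For each neighbor `u` of `v` it queries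
`x u`, and if `x u = 1`, it runs the edge oracle on every edge of `L` incident to `u`.
Returns `(Z value, set of entries of x queried, number of oracle calls on edges inside the part)`. -/
noncomputable def degOr (Ed : Finset (Sym2 V)) (π : Sym2 V → ℕ) (L : Finset (Sym2 V))
    (x : V → Bool) (v : V) : ℕ × Finset V × ℕ :=
  let Nv := Finset.univ.filter fun u => s(u, v) ∈ Ed
  let q := Nv ∪ (Nv.filter fun u => x u).biUnion fun u =>
      (Finset.univ.filter fun w => s(u, w) ∈ L).biUnion fun w =>
        (edgeOracle π L x s(u, w)).2.1
  let c := ∑ u ∈ Nv.filter (fun u => x u), ∑ w ∈ Finset.univ.filter (fun w => s(u, w) ∈ L),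
        (edgeOracle π L x s(u, w)).2.2
  ((Nv.filter fun u => x u ∧ ∀ w ∈ Finset.univ.filter (fun w => s(u, w) ∈ L),
      (edgeOracle π L x s(u, w)).1 = false).card, q, c)

/-- `B v`: the number of entries of `x` queried during the execution of the degree oracle. -/
noncomputable def Bqueries (Ed : Finset (Sym2 V)) (π : Sym2 V → ℕ) (L : Finset (Sym2 V))
    (x : V → Bool) (v : V) : ℕ :=
  (degOr Ed π L x v).2.1.card

/-- The priority function on edges induced by a permutation `τ` of `Fin E.card`,
via the canonical enumeration of `E`; edges outside `E` get priority `0`. -/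
noncomputable def prioOf (E : Finset (Sym2 V)) (τ : Equiv.Perm (Fin E.card)) (e : Sym2 V) : ℕ :=
  if h : e ∈ E then (τ (E.equivFin ⟨e, h⟩) : ℕ) else 0

/-- `L₁`: the set of edges of `L` with both endpoints inside the part `{v | x v}`. -/
noncomputable def partEdges (L : Finset (Sym2 V)) (x : V → Bool) : Finset (Sym2 V) :=
  L.filter fun e => ∀ v ∈ e, x v

/-- `Z_{v,1}(x)`: the number of neighbors of `v` in the graph `Ed` lying in the part
`{u | x u}` that are unmatched in `M₁ = GreedyMM(L₁, π)`. -/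
noncomputable def Zv1 (Ed : Finset (Sym2 V)) (π : Sym2 V → ℕ) (L : Finset (Sym2 V))
    (x : V → Bool) (v : V) : ℕ :=
  (Finset.univ.filter fun u =>
    s(u, v) ∈ Ed ∧ x u ∧ u ∉ matchedV (greedyMM π (partEdges L x))).card


/-- The matching output by Algorithm 1: the union over all parts `i ∈ [k]` of the greedy
maximal matching (w.r.t. the priorities `π`) of the induced subgraph of the sampled edge
set `L` on the part `V_i = χ⁻¹(i)`. -/
noncomputable def algoMatching (π : Sym2 V → ℕ) (k : ℕ) (χ : V → Fin k)
    (L : Finset (Sym2 V)) : Finset (Sym2 V) :=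
  (Finset.univ : Finset (Fin k)).biUnion fun i =>
    greedyMM π (L.filter fun e => ∀ w ∈ e, χ w = i)

/-- `Z_{v,i}`: the number of neighbors of `v` in the graph `Ed` that lie in part `V_i`
and are unmatched in the matching `M` output by Algorithm 1. -/
noncomputable def Zvi (Ed : Finset (Sym2 V)) (π : Sym2 V → ℕ) (k : ℕ) (χ : V → Fin k)
    (L : Finset (Sym2 V)) (v : V) (i : Fin k) : ℕ :=
  (Finset.univ.filter fun u =>
    s(u, v) ∈ Ed ∧ χ u = i ∧ u ∉ matchedV (algoMatching π k χ L)).card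

/-- `Z'_v`: equal to `Z_{v, χ(v)}` if `v` is unmatched in the output `M` of Algorithm 1,
and `0` if `v` is matched in `M`. -/
noncomputable def Zself (Ed : Finset (Sym2 V)) (π : Sym2 V → ℕ) (k : ℕ) (χ : V → Fin k)
    (L : Finset (Sym2 V)) (v : V) : ℕ :=
  if v ∈ matchedV (algoMatching π k χ L) then 0 else Zvi Ed π k χ L v (χ v)

/-- The Bernoulli product weight of the edge sample `S ⊆ Ed`, each edge kept with
probability `p`. -/
noncomputable def bwE (p : ℝ) (Ed S : Finset (Sym2 V)) : ℝ :=
  p ^ S.card * (1 - p) ^ (Ed.card - S.card)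

/-- The Bernoulli product weight of the indicator vector `x : V → Bool`, each coordinate
equal to `true` independently with probability `q`. -/
noncomputable def bwX (q : ℝ) (x : V → Bool) : ℝ :=
  q ^ (Finset.univ.filter fun v => x v = true).card *
    (1 - q) ^ (Finset.univ.filter fun v => x v = false).card

end Defs

section RandomGreedy

variable {T : Type*}

/-- The greedy maximal independent set of the graph `adj` with respect to priorities `ρ`. -/
def InGreedyMIS (adj : T → T → Prop) (ρ : T → ℕ) (x : T) : Prop :=
  ∀ y, adj x y → (_ : ρ y < ρ x) → ¬ InGreedyMIS adj ρ y
termination_by ρ x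

/-- No neighbor of `x` of priority less than `t` lies in the greedy MIS. -/
def FreeBelow (adj : T → T → Prop) (ρ : T → ℕ) (x : T) (t : ℕ) : Prop :=
  ∀ y, adj x y → ρ y < t → ¬ InGreedyMIS adj ρ y

/-- The local MIS oracle called on `x` recursively calls `y`. -/
def OracleCalls (adj : T → T → Prop) (ρ : T → ℕ) (x y : T) : Prop :=
  adj x y ∧ ρ y < ρ x ∧ FreeBelow adj ρ x (ρ y)

/-- The priorities `ρ` and `ρ'` agree on everything below `t`. -/
def AgreeBelow (ρ ρ' : T → ℕ) (t : ℕ) : Prop :=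
  ∀ x, ρ x < t ∨ ρ' x < t → ρ x = ρ' x

variable {adj : T → T → Prop} {ρ ρ' : T → ℕ}

lemma inGreedyMIS_iff (x : T) : InGreedyMIS adj ρ x ↔ FreeBelow adj ρ x (ρ x) := by
  rw [InGreedyMIS]; rfl

lemma FreeBelow.mono {x : T} {s t : ℕ} (h : FreeBelow adj ρ x t) (hst : s ≤ t) :
    FreeBelow adj ρ x s :=
  fun y hy hlt => h y hy (hlt.trans_le hst)

lemma AgreeBelow.inGreedyMIS_iff {t : ℕ} (h : AgreeBelow ρ ρ' t) (x : T) (hx : ρ x < t) :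
    InGreedyMIS adj ρ x ↔ InGreedyMIS adj ρ' x := by
  induction hn : ρ x using Nat.strong_induction_on generalizing x with
  | _ n ih =>
    subst hn
    have hxx := h x (Or.inl hx)
    rw [InGreedyMIS, InGreedyMIS]
    refine forall_congr' fun y => forall_congr' fun _ => ?_
    constructor
    · intro H hlt
      have hyy := h y (Or.inr (by omega))
      exact fun hc => H (by omega) ((ih (ρ y) (by omega) y (by omega) rfl).2 hc)
    · intro H hlt
      have hyy := h y (Or.inl (by omega))
      exact fun hc => H (by omega) ((ih (ρ y) (by omega) y (by omega) rfl).1 hc)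

lemma AgreeBelow.freeBelow {t s : ℕ} (h : AgreeBelow ρ ρ' t) (hs : s ≤ t) {x : T}
    (hf : FreeBelow adj ρ x s) : FreeBelow adj ρ' x s := by
  intro y hy hlt hm
  have hyy := h y (Or.inr (by omega))
  exact hf y hy (by omega) ((h.inGreedyMIS_iff y (by omega)).2 hm)

lemma AgreeBelow.oracleCalls {t : ℕ} (h : AgreeBelow ρ ρ' t) {x y : T} (hy : ρ y < t)
    (hx : ρ x ≤ ρ' x) (hq : OracleCalls adj ρ x y) : OracleCalls adj ρ' x y := by
  have hyy := h y (Or.inl hy)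
  refine ⟨hq.1, by have := hq.2.1; omega, ?_⟩
  rw [← hyy]
  exact h.freeBelow hy.le hq.2.2

/-- `OracleWalk adj ρ a b n x y`: there is a sequence `x, y, …, a, b` with `n` elements after `y`
which, from `y` on, is a chain of oracle calls, and whose first element `x` is free below the
priority of the third one. -/
inductive OracleWalk (adj : T → T → Prop) (ρ : T → ℕ) (a b : T) : ℕ → T → T → Prop
  | nil : OracleWalk adj ρ a b 0 a b
  | cons {n : ℕ} {x y z : T} : OracleCalls adj ρ y z → FreeBelow adj ρ x (ρ z) →
      OracleWalk adj ρ a b n y z → OracleWalk adj ρ a b (n + 1) x y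

lemma AgreeBelow.oracleWalk {t : ℕ} (h : AgreeBelow ρ ρ' t) {a b x y : T} {n : ℕ}
    (hw : OracleWalk adj ρ a b n x y) (hy : ρ y < t) : OracleWalk adj ρ' a b n x y := by
  induction hw with
  | nil => exact .nil
  | @cons n x y z hq hf _ ih =>
    have hz : ρ z < t := hq.2.1.trans hy
    refine .cons (h.oracleCalls hz (h y (Or.inl hy)).le hq) ?_ (ih hz)
    rw [← h z (Or.inl hz)]
    exact h.freeBelow hz.le hf

lemma AgreeBelow.oracleWalk_of_le {a b x y : T} {n : ℕ} (h : AgreeBelow ρ ρ' (ρ y))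
    (hw : OracleWalk adj ρ a b n x y) (hy : ρ y ≤ ρ' y) : OracleWalk adj ρ' a b n x y := by
  cases hw with
  | nil => exact .nil
  | @cons n x y z hq hf hw =>
    refine .cons (h.oracleCalls hq.2.1 hy hq) ?_ (h.oracleWalk hw hq.2.1)
    rw [← h z (Or.inl hq.2.1)]
    exact h.freeBelow hq.2.1.le hf

lemma exists_oracleWalk {e a b : T} (h : Relation.ReflTransGen (OracleCalls adj ρ) e a)
    (hab : OracleCalls adj ρ a b) :
    ∃ n y, OracleCalls adj ρ e y ∧ OracleWalk adj ρ a b n e y := by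
  induction h using Relation.ReflTransGen.head_induction_on with
  | refl => exact ⟨0, b, hab, .nil⟩
  | head hec _ ih =>
    obtain ⟨n, y, hq, hw⟩ := ih
    exact ⟨n + 1, _, hec, .cons hq (hec.2.2.mono hq.2.1.le) hw⟩

variable {N : ℕ}

/-- The priorities given by a permutation. -/
def permPrio (τ : Equiv.Perm (Fin N)) (i : Fin N) : ℕ := (τ i : ℕ)

lemma permPrio_injective (τ : Equiv.Perm (Fin N)) : Function.Injective (permPrio τ) :=
  fun _ _ h => τ.injective (Fin.ext h)

/-- The cyclic shift `x ↦ z ↦ y ↦ x`. -/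
def rotate3 (x y z : Fin N) : Equiv.Perm (Fin N) := Equiv.swap x z * Equiv.swap y z

/-- One step of the rotation of priorities along a path of oracle calls.  The state
`(τ, x, y)` moves to `(τ', y, z)`, where `x` becomes the first neighbor of `y` in the greedy
MIS and precedes `z`. -/
def RotStep (adj : Fin N → Fin N → Prop)
    (s s' : Equiv.Perm (Fin N) × Fin N × Fin N) : Prop :=
  s'.2.1 = s.2.2 ∧ s'.1 = s.1 * rotate3 s.2.1 s.2.2 s'.2.2 ∧ adj s.2.2 s.2.1 ∧
    permPrio s'.1 s.2.1 < permPrio s'.1 s'.2.2 ∧ InGreedyMIS adj (permPrio s'.1) s.2.1 ∧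
    FreeBelow adj (permPrio s'.1) s.2.2 (permPrio s'.1 s.2.1)

lemma RotStep.left_unique {adj : Fin N → Fin N → Prop}
    {s₁ s₂ s : Equiv.Perm (Fin N) × Fin N × Fin N}
    (h₁ : RotStep adj s₁ s) (h₂ : RotStep adj s₂ s) : s₁ = s₂ := by
  obtain ⟨τ₁, x₁, y₁⟩ := s₁
  obtain ⟨τ₂, x₂, y₂⟩ := s₂
  obtain ⟨τ, y, z⟩ := s
  obtain ⟨e₁, c₁, a₁, l₁, m₁, f₁⟩ := h₁
  obtain ⟨e₂, c₂, a₂, l₂, m₂, f₂⟩ := h₂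
  simp only at *
  subst e₁
  subst e₂
  have hx : x₁ = x₂ := by
    rcases lt_trichotomy (permPrio τ x₁) (permPrio τ x₂) with h | h | h
    · exact absurd m₁ (f₂ _ a₁ h)
    · exact permPrio_injective τ h
    · exact absurd m₂ (f₁ _ a₂ h)
  subst hx
  rw [c₁] at c₂
  rw [mul_right_cancel c₂]

/-- Both ends of a valid initial state: the first vertex is free below the second one. -/
def RotInit (adj : Fin N → Fin N → Prop) (s : Equiv.Perm (Fin N) × Fin N × Fin N) : Prop :=
  FreeBelow adj (permPrio s.1) s.2.1 (permPrio s.1 s.2.2)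

lemma RotStep.not_init {adj : Fin N → Fin N → Prop}
    {s s' : Equiv.Perm (Fin N) × Fin N × Fin N} (h : RotStep adj s s') : ¬ RotInit adj s' := by
  obtain ⟨e, -, a, l, m, -⟩ := h
  intro hi
  exact hi s.2.1 (e ▸ a) l m

lemma rotInit_unique {adj : Fin N → Fin N → Prop}
    {s₁ s₂ s : Equiv.Perm (Fin N) × Fin N × Fin N}
    (i₁ : RotInit adj s₁) (i₂ : RotInit adj s₂)
    (h₁ : Relation.ReflTransGen (RotStep adj) s₁ s)
    (h₂ : Relation.ReflTransGen (RotStep adj) s₂ s) : s₁ = s₂ := by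
  induction h₁ with
  | refl =>
    rcases Relation.ReflTransGen.cases_tail h₂ with h | ⟨c, -, hc⟩
    · exact h
    · exact absurd i₁ hc.not_init
  | tail _ hb ih =>
    rcases Relation.ReflTransGen.cases_tail h₂ with h | ⟨c, hc, hc'⟩
    · subst h
      exact absurd i₂ hb.not_init
    · rw [hc'.left_unique hb] at hc
      exact ih hc

lemma permPrio_rotate3 (τ : Equiv.Perm (Fin N)) {x y z : Fin N}
    (hxy : x ≠ y) (hyz : y ≠ z) (hxz : x ≠ z) :
    permPrio (τ * rotate3 x y z) x = permPrio τ z ∧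
    permPrio (τ * rotate3 x y z) y = permPrio τ x ∧
    permPrio (τ * rotate3 x y z) z = permPrio τ y ∧
    ∀ w, w ≠ x → w ≠ y → w ≠ z → permPrio (τ * rotate3 x y z) w = permPrio τ w := by
  refine ⟨?_, ?_, ?_, ?_⟩
  · simp [permPrio, rotate3, Equiv.swap_apply_of_ne_of_ne hxy hxz]
  · simp [permPrio, rotate3]
  · simp [permPrio, rotate3, Equiv.swap_apply_of_ne_of_ne hxy.symm hyz]
  · intro w h1 h2 h3
    simp [permPrio, rotate3, Equiv.swap_apply_of_ne_of_ne, h1, h2, h3]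

lemma OracleWalk.exists_rotStep {adj : Fin N → Fin N → Prop} (hadj : ∀ ⦃x y⦄, adj x y → adj y x)
    {a b : Fin N} (n : ℕ) (τ : Equiv.Perm (Fin N)) (x y : Fin N)
    (hw : OracleWalk adj (permPrio τ) a b n x y) (hxy : adj x y)
    (hlt : permPrio τ y < permPrio τ x) :
    ∃ τ', Relation.ReflTransGen (RotStep adj) (τ, x, y) (τ', a, b) := by
  induction n generalizing τ x y with
  | zero =>
    cases hw
    exact ⟨τ, .refl⟩
  | succ n ih =>
    cases hw with
    | @cons _ _ _ z hq hf hw =>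
      have hzy := hq.2.1
      obtain ⟨rx, ry, rz, rw'⟩ := permPrio_rotate3 τ (x := x) (y := y) (z := z)
        (by rintro rfl; omega) (by rintro rfl; omega) (by rintro rfl; omega)
      set τ' := τ * rotate3 x y z with hτ'
      have hag : AgreeBelow (permPrio τ) (permPrio τ') (permPrio τ z) := by
        intro w h
        by_cases h1 : w = x
        · subst h1; omega
        by_cases h2 : w = y
        · subst h2; omega
        by_cases h3 : w = z
        · subst h3; omega
        exact (rw' w h1 h2 h3).symm
      obtain ⟨σ, hσ⟩ := ih τ' y z (hag.oracleWalk_of_le hw (by omega)) hq.1 (by omega)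
      refine ⟨σ, .head ⟨rfl, hτ', hadj hxy, ?_, ?_, ?_⟩ hσ⟩
      · simp only; omega
      · rw [inGreedyMIS_iff]
        simp only [rx]
        exact hag.freeBelow le_rfl hf
      · simp only [rx]
        exact hag.freeBelow le_rfl hq.2.2

open Classical in
lemma card_oracle_reach_through_le {adj : Fin N → Fin N → Prop} (hadj : ∀ ⦃x y⦄, adj x y → adj y x)
    (a b : Fin N) :
    ∑ τ : Equiv.Perm (Fin N), (Finset.univ.filter fun e =>
      Relation.ReflTransGen (OracleCalls adj (permPrio τ)) e a ∧
        OracleCalls adj (permPrio τ) a b).card ≤ Fintype.card (Equiv.Perm (Fin N)) := by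
  rw [← Finset.card_sigma, ← Finset.card_univ]
  have key : ∀ q : (_ : Equiv.Perm (Fin N)) × Fin N, ∃ τ' : Equiv.Perm (Fin N),
      (Relation.ReflTransGen (OracleCalls adj (permPrio q.1)) q.2 a ∧
        OracleCalls adj (permPrio q.1) a b) →
      ∃ y, RotInit adj (q.1, q.2, y) ∧
        Relation.ReflTransGen (RotStep adj) (q.1, q.2, y) (τ', a, b) := by
    intro q
    by_cases h : Relation.ReflTransGen (OracleCalls adj (permPrio q.1)) q.2 a ∧
        OracleCalls adj (permPrio q.1) a b
    · obtain ⟨n, y, hy, hw⟩ := exists_oracleWalk h.1 h.2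
      obtain ⟨τ', hτ'⟩ := hw.exists_rotStep hadj n q.1 q.2 y hy.1 hy.2.1
      exact ⟨τ', fun _ => ⟨y, hy.2.2, hτ'⟩⟩
    · exact ⟨1, fun h' => absurd h' h⟩
  choose φ hφ using key
  refine Finset.card_le_card_of_injOn φ (fun _ _ => Finset.mem_coe.2 (Finset.mem_univ _)) ?_
  intro q₁ h₁ q₂ h₂ heq
  obtain ⟨y₁, i₁, r₁⟩ := hφ q₁ (by simpa using h₁)
  obtain ⟨y₂, i₂, r₂⟩ := hφ q₂ (by simpa using h₂)
  rw [heq] at r₁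
  have := rotInit_unique i₁ i₂ r₁ r₂
  simp only [Prod.mk.injEq] at this
  exact Sigma.ext this.1 (heq_of_eq this.2.1)

open Classical in
/-- The expected number of vertices from which the local MIS oracle reaches `f`, for random
priorities, is at most one plus the degree of `f`. -/
lemma sum_card_oracle_reach_le {adj : Fin N → Fin N → Prop} (hadj : ∀ ⦃x y⦄, adj x y → adj y x)
    (f : Fin N) :
    ∑ τ : Equiv.Perm (Fin N), (Finset.univ.filter fun e =>
      Relation.ReflTransGen (OracleCalls adj (permPrio τ)) e f).card ≤
      Fintype.card (Equiv.Perm (Fin N)) * (1 + (Finset.univ.filter fun a => adj a f).card) := by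
  calc _ ≤ ∑ τ : Equiv.Perm (Fin N), (1 + ∑ a ∈ Finset.univ.filter fun a => adj a f,
        (Finset.univ.filter fun e =>
          Relation.ReflTransGen (OracleCalls adj (permPrio τ)) e a ∧
            OracleCalls adj (permPrio τ) a f).card) := by
        refine Finset.sum_le_sum fun τ _ => ?_
        have : (Finset.univ.filter fun e =>
            Relation.ReflTransGen (OracleCalls adj (permPrio τ)) e f) ⊆
            {f} ∪ (Finset.univ.filter fun a => adj a f).biUnion fun a =>
              Finset.univ.filter fun e =>
                Relation.ReflTransGen (OracleCalls adj (permPrio τ)) e a ∧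
                  OracleCalls adj (permPrio τ) a f := by
          intro e he
          simp only [Finset.mem_filter, Finset.mem_univ, true_and] at he
          rcases Relation.ReflTransGen.cases_tail he with h | ⟨a, h, h'⟩
          · simp [h]
          · refine Finset.mem_union_right _ (Finset.mem_biUnion.2 ⟨a, ?_, ?_⟩)
            · simpa using h'.1
            · simpa using ⟨h, h'⟩
        refine (Finset.card_le_card this).trans ((Finset.card_union_le _ _).trans ?_)
        rw [Finset.card_singleton]
        exact Nat.add_le_add_left Finset.card_biUnion_le _
    _ ≤ _ := by
        rw [Finset.sum_add_distrib, Finset.sum_comm, mul_add]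
        refine Nat.add_le_add (by simp) ?_
        refine (Finset.sum_le_sum fun a _ => card_oracle_reach_through_le hadj a f).trans ?_
        rw [Finset.sum_const, smul_eq_mul, mul_comm]

end RandomGreedy

section Oracle

variable {V : Type*} [Fintype V] [DecidableEq V]

/-- Two edges share an endpoint. -/
def EdgesMeet (e f : Sym2 V) : Prop := ∃ v, v ∈ e ∧ v ∈ f

/-- Adjacency in the line graph (with loops) of the edges inside the part `{v | x v}`. -/
def partAdj {T : Type*} (ed : T → Sym2 V) (S : Finset (Sym2 V)) (x : V → Bool) (i j : T) : Prop :=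
  ed i ∈ partEdges S x ∧ ed j ∈ partEdges S x ∧ EdgesMeet (ed i) (ed j)

lemma partAdj_symm {T : Type*} {ed : T → Sym2 V} {S : Finset (Sym2 V)} {x : V → Bool} ⦃i j : T⦄
    (h : partAdj ed S x i j) : partAdj ed S x j i :=
  ⟨h.2.1, h.1, h.2.2.imp fun _ hv => hv.symm⟩

section Foldl

variable {α : Type*} (F : α → Bool × Finset V × ℕ)

/-- One step of the loop of the edge oracle. -/
noncomputable def oracleStep (s : Bool × Finset V × ℕ) (f : α) : Bool × Finset V × ℕ :=
  if s.1 then s else ((F f).1, s.2.1 ∪ (F f).2.1, s.2.2 + (F f).2.2)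

omit [Fintype V] in
lemma foldl_oracleStep_of_true (l : List α) (s : Bool × Finset V × ℕ) (hs : s.1 = true) :
    l.foldl (oracleStep F) s = s := by
  induction l with
  | nil => rfl
  | cons f l ih => rw [List.foldl_cons, oracleStep, if_pos hs, ih]

omit [Fintype V] in
lemma foldl_oracleStep_fst (l : List α) (s : Bool × Finset V × ℕ) (hs : s.1 = false) :
    (l.foldl (oracleStep F) s).1 = true ↔ ∃ f ∈ l, (F f).1 = true := by
  induction l generalizing s with
  | nil => simp [hs]
  | cons f l ih =>
    rw [List.foldl_cons, oracleStep, if_neg (by simp [hs])]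
    by_cases hf : (F f).1 = true
    · rw [foldl_oracleStep_of_true F _ _ (by exact hf)]
      simp [hf]
    · rw [ih _ (by simpa using hf)]
      simp [hf]

omit [Fintype V] in
lemma mem_foldl_oracleStep (l : List α) (s : Bool × Finset V × ℕ) (v : V)
    (hv : v ∈ (l.foldl (oracleStep F) s).2.1) :
    v ∈ s.2.1 ∨ ∃ l₁ f l₂, l = l₁ ++ f :: l₂ ∧ (∀ g ∈ l₁, (F g).1 = false) ∧ v ∈ (F f).2.1 := by
  induction l generalizing s with
  | nil => exact Or.inl hv
  | cons f l ih =>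
    rw [List.foldl_cons, oracleStep] at hv
    by_cases hs : s.1 = true
    · rw [if_pos hs, foldl_oracleStep_of_true _ _ _ hs] at hv
      exact Or.inl hv
    rw [if_neg hs] at hv
    by_cases hf : (F f).1 = true
    · rw [foldl_oracleStep_of_true F _ _ (by exact hf)] at hv
      rcases Finset.mem_union.1 hv with h | h
      · exact Or.inl h
      · exact Or.inr ⟨[], f, l, rfl, by simp, h⟩
    · rcases ih _ hv with h | ⟨l₁, g, l₂, rfl, h₁, h₂⟩
      · rcases Finset.mem_union.1 h with h | h
        · exact Or.inl h
        · exact Or.inr ⟨[], f, l, rfl, by simp, h⟩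
      · refine Or.inr ⟨f :: l₁, g, l₂, rfl, ?_, h₂⟩
        intro k hk
        rcases List.mem_cons.1 hk with rfl | hk
        · simpa using hf
        · exact h₁ k hk

end Foldl

/-- The sampled edges of smaller priority meeting `e`, in increasing order of priority. -/
noncomputable def lowerEdges (π : Sym2 V → ℕ) (S : Finset (Sym2 V)) (e : Sym2 V) :
    List (Sym2 V) :=
  (S.filter fun f => f ≠ e ∧ (∃ v, v ∈ e ∧ v ∈ f) ∧ π f < π e).toList.mergeSort
    (fun a b => decide (π a ≤ π b))

lemma mem_lowerEdges {π : Sym2 V → ℕ} {S : Finset (Sym2 V)} {e f : Sym2 V} :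
    f ∈ lowerEdges π S e ↔ f ∈ S ∧ EdgesMeet e f ∧ π f < π e := by
  simp only [lowerEdges, List.mem_mergeSort, Finset.mem_toList, Finset.mem_filter, EdgesMeet]
  constructor
  · rintro ⟨h, -, h'⟩
    exact ⟨h, h'⟩
  · rintro ⟨h, h', h''⟩
    exact ⟨h, by rintro rfl; omega, h', h''⟩

lemma pairwise_lowerEdges (π : Sym2 V → ℕ) (S : Finset (Sym2 V)) (e : Sym2 V) :
    (lowerEdges π S e).Pairwise fun a b => π a ≤ π b := by
  have := List.pairwise_mergeSort (le := fun a b => decide (π a ≤ π b))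
    (fun a b c h h' => by simp only [decide_eq_true_eq] at *; omega)
    (fun a b => by simp only [Bool.or_eq_true, decide_eq_true_eq]; omega)
    (S.filter fun f => f ≠ e ∧ (∃ v, v ∈ e ∧ v ∈ f) ∧ π f < π e).toList
  simpa [lowerEdges] using this

lemma eoQ_succ (π : Sym2 V → ℕ) (S : Finset (Sym2 V)) (x : V → Bool) (n : ℕ) (e : Sym2 V) :
    eoQ π S x (n + 1) e =
      if ∀ v ∈ e, x v then
        let r := (lowerEdges π S e).foldl (oracleStep (eoQ π S x n)) (false, ∅, 0)
        (!r.1, ends e ∪ r.2.1, (if e ∈ S then 1 else 0) + r.2.2)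
      else (false, ends e, 0) := by
  rw [eoQ]
  rfl

lemma eoQ_spec {T : Type*} {ed : T → Sym2 V} {π : Sym2 V → ℕ} {S : Finset (Sym2 V)}
    {x : V → Bool} (hS : ∀ e ∈ S, ∃ i, ed i = e) (n : ℕ) (i : T) (hn : π (ed i) < n)
    (hi : ed i ∈ S) :
    ((eoQ π S x n (ed i)).1 = true ↔
      ed i ∈ partEdges S x ∧ InGreedyMIS (partAdj ed S x) (fun j => π (ed j)) i) ∧
    ∀ v ∈ (eoQ π S x n (ed i)).2.1, v ∈ ed i ∨ ed i ∈ partEdges S x ∧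
      ∃ j, Relation.ReflTransGen (OracleCalls (partAdj ed S x) fun j => π (ed j)) i j ∧
        ed j ∈ partEdges S x ∧ ∃ g ∈ S, EdgesMeet (ed j) g ∧ v ∈ g := by
  induction n generalizing i with
  | zero => omega
  | succ n ih =>
    rw [eoQ_succ]
    by_cases hx : ∀ v ∈ ed i, x v = true
    swap
    · rw [if_neg hx]
      refine ⟨?_, fun v hv => Or.inl (by simpa [ends] using hv)⟩
      simp only [Bool.false_eq_true, false_iff]
      rintro ⟨h, -⟩
      exact hx (Finset.mem_filter.1 h).2
    rw [if_pos hx]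
    have hpi : ed i ∈ partEdges S x := Finset.mem_filter.2 ⟨hi, hx⟩
    have ih' : ∀ j, ed j ∈ lowerEdges π S (ed i) → _ := fun j hj =>
      ih j (by have := (mem_lowerEdges.1 hj).2.2; omega) (mem_lowerEdges.1 hj).1
    refine ⟨?_, ?_⟩
    · simp only [Bool.not_eq_true', hpi, true_and]
      rw [← Bool.not_eq_true, foldl_oracleStep_fst _ _ _ rfl, InGreedyMIS]
      push Not
      constructor
      · intro H j hj hlt hm
        have hjl : ed j ∈ lowerEdges π S (ed i) :=
          mem_lowerEdges.2 ⟨(Finset.mem_filter.1 hj.2.1).1, hj.2.2, hlt⟩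
        exact H _ hjl ((ih' j hjl).1.2 ⟨hj.2.1, hm⟩)
      · intro H f hf ht
        obtain ⟨j, rfl⟩ := hS f (mem_lowerEdges.1 hf).1
        obtain ⟨h₁, h₂⟩ := (ih' j hf).1.1 ht
        exact H j ⟨hpi, h₁, (mem_lowerEdges.1 hf).2.1⟩ (mem_lowerEdges.1 hf).2.2 h₂
    · intro v hv
      rcases Finset.mem_union.1 hv with hv | hv
      · exact Or.inl (by simpa [ends] using hv)
      refine Or.inr ⟨hpi, ?_⟩
      rcases mem_foldl_oracleStep _ _ _ _ hv with hv | ⟨l₁, f, l₂, hl, hl₁, hv⟩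
      · simp at hv
      have hf : f ∈ lowerEdges π S (ed i) := by rw [hl]; simp
      obtain ⟨j, rfl⟩ := hS f (mem_lowerEdges.1 hf).1
      have hf' := mem_lowerEdges.1 hf
      rcases (ih' j hf).2 v hv with hv | ⟨hj, k, hk, hk'⟩
      · exact ⟨i, .refl, hpi, ed j, hf'.1, hf'.2.1, hv⟩
      · refine ⟨k, .head ⟨⟨hpi, hj, hf'.2.1⟩, hf'.2.2, ?_⟩ hk, hk'⟩
        intro y hy hlt hm
        simp only at hlt
        have hyl : ed y ∈ lowerEdges π S (ed i) :=
          mem_lowerEdges.2 ⟨(Finset.mem_filter.1 hy.2.1).1, hy.2.2, hlt.trans hf'.2.2⟩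
        have hp := pairwise_lowerEdges π S (ed i)
        have hyt := (ih' y hyl).1.2 ⟨hy.2.1, hm⟩
        rw [hl] at hyl hp
        rcases List.mem_append.1 hyl with h | h
        · rw [hl₁ _ h] at hyt
          exact absurd hyt (by simp)
        · rcases List.mem_cons.1 h with h | h
          · rw [h] at hlt; omega
          · have := (List.pairwise_cons.1 (List.pairwise_append.1 hp).2.1).1 _ h
            omega

/-- The number of edges of `S` meeting `e`. -/
noncomputable def meetCount (S : Finset (Sym2 V)) (e : Sym2 V) : ℕ :=
  (S.filter fun g => EdgesMeet e g).card

lemma card_ends_le (e : Sym2 V) : (ends e).card ≤ 2 := by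
  induction e with
  | _ a b =>
    have : ends s(a, b) ⊆ {a, b} := by
      intro v hv
      simpa [ends] using hv
    exact (Finset.card_le_card this).trans Finset.card_le_two

lemma card_edgeOracle_le {T : Type*} [Fintype T] {ed : T → Sym2 V} {π : Sym2 V → ℕ}
    {S : Finset (Sym2 V)} {x : V → Bool} (hS : ∀ e ∈ S, ∃ i, ed i = e) (i : T)
    (hi : ed i ∈ S) :
    (edgeOracle π S x (ed i)).2.1.card ≤ 2 + ∑ j ∈ Finset.univ.filter (fun j =>
      ed j ∈ partEdges S x ∧
        Relation.ReflTransGen (OracleCalls (partAdj ed S x) fun j => π (ed j)) i j),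
      2 * meetCount S (ed j) := by
  have hsub : (edgeOracle π S x (ed i)).2.1 ⊆ ends (ed i) ∪
      (Finset.univ.filter (fun j => ed j ∈ partEdges S x ∧
        Relation.ReflTransGen (OracleCalls (partAdj ed S x) fun j => π (ed j)) i j)).biUnion
      fun j => (S.filter fun g => EdgesMeet (ed j) g).biUnion ends := by
    intro v hv
    rcases (eoQ_spec hS _ i (Nat.lt_succ_self _) hi).2 v hv with h | ⟨-, j, h₁, h₂, g, hg, h₃, h₄⟩
    · exact Finset.mem_union_left _ (by simpa [ends] using h)
    · refine Finset.mem_union_right _ (Finset.mem_biUnion.2 ⟨j, ?_, Finset.mem_biUnion.2 ⟨g, ?_, ?_⟩⟩)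
      · simpa using ⟨h₂, h₁⟩
      · simpa using ⟨hg, h₃⟩
      · simpa [ends] using h₄
  refine (Finset.card_le_card hsub).trans ((Finset.card_union_le _ _).trans ?_)
  refine Nat.add_le_add (card_ends_le _) (Finset.card_biUnion_le.trans ?_)
  refine Finset.sum_le_sum fun j _ => Finset.card_biUnion_le.trans ?_
  rw [meetCount, mul_comm]
  exact Finset.sum_le_card_nsmul _ _ _ fun g _ => card_ends_le g

lemma sum_adjacent_pairs_le (S : Finset (Sym2 V)) (F : Sym2 V → ℕ) :
    ∑ u : V, ∑ w ∈ Finset.univ.filter (fun w => s(u, w) ∈ S), F s(u, w) ≤ 2 * ∑ e ∈ S, F e := by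
  have h1 : ∑ u : V, ∑ w ∈ Finset.univ.filter (fun w => s(u, w) ∈ S), F s(u, w) =
      ∑ q ∈ (Finset.univ : Finset (V × V)).filter (fun q => s(q.1, q.2) ∈ S), F s(q.1, q.2) := by
    simp only [Finset.sum_filter]
    rw [Fintype.sum_prod_type]
  rw [h1, ← Finset.sum_fiberwise_of_maps_to (t := S) (g := fun q : V × V => s(q.1, q.2))
    (fun q hq => (Finset.mem_filter.1 hq).2), Finset.mul_sum]
  refine Finset.sum_le_sum fun e _ => ?_
  rw [Finset.sum_congr rfl (g := fun _ => F e)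
    (fun q hq => by rw [(Finset.mem_filter.1 hq).2]), Finset.sum_const, smul_eq_mul]
  refine Nat.mul_le_mul_right _ ?_
  induction e with
  | _ a b =>
    refine (Finset.card_le_card (t := {(a, b), (b, a)}) ?_).trans Finset.card_le_two
    intro q hq
    have := (Finset.mem_filter.1 hq).2
    rw [Sym2.eq_iff] at this
    simpa [Prod.ext_iff] using this

lemma card_neighbors_le {E : Finset (Sym2 V)} {Δ : ℕ}
    (hΔ : ∀ v : V, (E.filter fun e => v ∈ e).card ≤ Δ) (u : V) :
    (Finset.univ.filter fun v => s(u, v) ∈ E).card ≤ Δ := by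
  refine le_trans (Finset.card_le_card_of_injOn (fun v => s(u, v)) ?_ ?_) (hΔ u)
  · intro v hv
    simpa using hv
  · intro v _ w _ h
    exact Sym2.congr_right.1 h

lemma card_edges_le {E : Finset (Sym2 V)} {Δ : ℕ}
    (hΔ : ∀ v : V, (E.filter fun e => v ∈ e).card ≤ Δ) : E.card ≤ Fintype.card V * Δ := by
  have hsub : E ⊆ Finset.univ.biUnion fun v : V => E.filter fun e => v ∈ e := by
    intro e he
    exact Finset.mem_biUnion.2
      ⟨(Quot.out e).1, Finset.mem_univ _, Finset.mem_filter.2 ⟨he, Sym2.out_fst_mem e⟩⟩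
  refine (Finset.card_le_card hsub).trans (Finset.card_biUnion_le.trans ?_)
  exact Finset.sum_le_card_nsmul _ _ _ fun v _ => hΔ v

lemma meetCount_le {E : Finset (Sym2 V)} {Δ : ℕ}
    (hΔ : ∀ v : V, (E.filter fun e => v ∈ e).card ≤ Δ) (e : Sym2 V) :
    meetCount E e ≤ 2 * Δ := by
  have hsub : (E.filter fun g => EdgesMeet e g) ⊆
      (ends e).biUnion fun v => E.filter fun g => v ∈ g := by
    intro g hg
    obtain ⟨hg, v, hv, hv'⟩ := Finset.mem_filter.1 hg
    exact Finset.mem_biUnion.2 ⟨v, by simpa [ends] using hv, Finset.mem_filter.2 ⟨hg, hv'⟩⟩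
  refine (Finset.card_le_card hsub).trans (Finset.card_biUnion_le.trans ?_)
  exact (Finset.sum_le_card_nsmul _ _ _ fun v _ => hΔ v).trans
    (Nat.mul_le_mul_right _ (card_ends_le e))

lemma sum_Bqueries_le {E S : Finset (Sym2 V)} {Δ : ℕ}
    (hΔ : ∀ v : V, (E.filter fun e => v ∈ e).card ≤ Δ) (π : Sym2 V → ℕ) (x : V → Bool) :
    ∑ v, Bqueries E π S x v ≤ Fintype.card V * Δ +
      Δ * (2 * ∑ e ∈ S, (edgeOracle π S x e).2.1.card) := by
  have hB : ∀ v, Bqueries E π S x v ≤ Δ + ∑ u ∈ Finset.univ.filter (fun u => s(u, v) ∈ E),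
      ∑ w ∈ Finset.univ.filter (fun w => s(u, w) ∈ S), (edgeOracle π S x s(u, w)).2.1.card := by
    intro v
    refine (Finset.card_union_le _ _).trans (Nat.add_le_add ?_ ?_)
    · simpa only [Sym2.eq_swap] using card_neighbors_le hΔ v
    · refine Finset.card_biUnion_le.trans ?_
      refine (Finset.sum_le_sum fun u _ => Finset.card_biUnion_le).trans ?_
      exact Finset.sum_le_sum_of_subset (Finset.filter_subset _ _)
  refine (Finset.sum_le_sum fun v _ => hB v).trans ?_
  rw [Finset.sum_add_distrib]
  refine Nat.add_le_add (by simp) ?_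
  simp only [Finset.sum_filter (fun u => s(u, _) ∈ E)]
  rw [Finset.sum_comm]
  refine le_trans ?_ (Nat.mul_le_mul_left Δ
    (sum_adjacent_pairs_le S fun e => (edgeOracle π S x e).2.1.card))
  rw [Finset.mul_sum]
  refine Finset.sum_le_sum fun u _ => ?_
  rw [← Finset.sum_filter, Finset.sum_const, smul_eq_mul]
  exact Nat.mul_le_mul_right _ (card_neighbors_le hΔ u)

/-- The edge of `E` with a given index. -/
noncomputable def edgeAt (E : Finset (Sym2 V)) (i : Fin E.card) : Sym2 V := E.equivFin.symm i

omit [Fintype V] in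
lemma sum_edgeAt {E S : Finset (Sym2 V)} (hS : S ⊆ E) (F : Sym2 V → ℕ) :
    ∑ i ∈ Finset.univ.filter (fun i => edgeAt E i ∈ S), F (edgeAt E i) = ∑ e ∈ S, F e := by
  refine Finset.sum_bij (fun i _ => edgeAt E i) (fun i hi => (Finset.mem_filter.1 hi).2)
    (fun i _ j _ h => E.equivFin.symm.injective (Subtype.ext h)) ?_ (fun _ _ => rfl)
  intro e he
  have h : edgeAt E (E.equivFin ⟨e, hS he⟩) = e := by simp [edgeAt]
  exact ⟨_, Finset.mem_filter.2 ⟨Finset.mem_univ _, h.symm ▸ he⟩, h⟩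

omit [Fintype V] in
lemma prioOf_edgeAt (E : Finset (Sym2 V)) (τ : Equiv.Perm (Fin E.card)) (i : Fin E.card) :
    prioOf E τ (edgeAt E i) = permPrio τ i := by
  have h : edgeAt E i ∈ E := (E.equivFin.symm i).2
  rw [prioOf, dif_pos h]
  simp [edgeAt, permPrio]

lemma sum_card_edgeOracle_le_reach {E S : Finset (Sym2 V)} (hS : S ⊆ E) (x : V → Bool)
    (τ : Equiv.Perm (Fin E.card)) :
    ∑ e ∈ S, (edgeOracle (prioOf E τ) S x e).2.1.card ≤ 2 * S.card +
      ∑ j ∈ Finset.univ.filter (fun j => edgeAt E j ∈ partEdges S x),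
        2 * meetCount S (edgeAt E j) * (Finset.univ.filter fun i =>
          Relation.ReflTransGen (OracleCalls (partAdj (edgeAt E) S x) (permPrio τ)) i j).card := by
  have hex : ∀ e ∈ S, ∃ i, edgeAt E i = e := fun e he =>
    ⟨E.equivFin ⟨e, hS he⟩, by simp [edgeAt]⟩
  rw [← sum_edgeAt hS fun e => (edgeOracle (prioOf E τ) S x e).2.1.card]
  have hfun : (fun j => prioOf E τ (edgeAt E j)) = permPrio τ :=
    funext fun j => prioOf_edgeAt E τ j
  refine (Finset.sum_le_sum fun i hi =>
    card_edgeOracle_le hex i (Finset.mem_filter.1 hi).2).trans ?_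
  rw [Finset.sum_add_distrib, sum_edgeAt hS fun _ => 2, hfun]
  refine Nat.add_le_add (by simp [mul_comm]) ?_
  refine (Finset.sum_le_sum_of_subset (Finset.filter_subset _ _)).trans ?_
  simp only [Finset.sum_filter, ite_and]
  rw [Finset.sum_comm]
  refine Finset.sum_le_sum fun j _ => ?_
  split_ifs
  · rw [← Finset.sum_filter, Finset.sum_const, smul_eq_mul, mul_comm]
  · simp

lemma one_add_card_partAdj_le {E S : Finset (Sym2 V)} {x : V → Bool} {j : Fin E.card}
    (hj : edgeAt E j ∈ partEdges S x) :
    1 + (Finset.univ.filter fun a => partAdj (edgeAt E) S x a j).card ≤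
      2 * meetCount (partEdges S x) (edgeAt E j) := by
  have h1 : (Finset.univ.filter fun a => partAdj (edgeAt E) S x a j).card ≤
      meetCount (partEdges S x) (edgeAt E j) := by
    refine Finset.card_le_card_of_injOn (edgeAt E) ?_
      (fun i _ j _ h => E.equivFin.symm.injective (Subtype.ext h))
    intro a ha
    have ha' := (Finset.mem_filter.1 (Finset.mem_coe.1 ha)).2
    exact Finset.mem_coe.2 (Finset.mem_filter.2 ⟨ha'.1, (partAdj_symm ha').2.2⟩)
  have h2 : 1 ≤ meetCount (partEdges S x) (edgeAt E j) :=
    Finset.card_pos.2 ⟨edgeAt E j, Finset.mem_filter.2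
      ⟨hj, _, Sym2.out_fst_mem _, Sym2.out_fst_mem _⟩⟩
  omega

lemma sum_card_edgeOracle_le {E S : Finset (Sym2 V)} (hS : S ⊆ E) (x : V → Bool) :
    ∑ τ : Equiv.Perm (Fin E.card), ∑ e ∈ S, (edgeOracle (prioOf E τ) S x e).2.1.card ≤
      Fintype.card (Equiv.Perm (Fin E.card)) *
        (2 * S.card + 4 * ∑ f ∈ partEdges S x,
          meetCount (partEdges S x) f * meetCount S f) := by
  have hLE : partEdges S x ⊆ E := (Finset.filter_subset _ _).trans hS
  have hreach (j : Fin E.card) (hj : edgeAt E j ∈ partEdges S x) :=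
    (sum_card_oracle_reach_le (adj := partAdj (edgeAt E) S x)
      (fun _ _ h => partAdj_symm h) j).trans
      (Nat.mul_le_mul_left _ (one_add_card_partAdj_le hj))
  have hcard : ∑ _τ : Equiv.Perm (Fin E.card), 2 * S.card =
      Fintype.card (Equiv.Perm (Fin E.card)) * (2 * S.card) := by
    rw [Finset.sum_const, Finset.card_univ, smul_eq_mul]
  refine (Finset.sum_le_sum fun τ _ => sum_card_edgeOracle_le_reach hS x τ).trans ?_
  rw [Finset.sum_add_distrib, Finset.sum_comm, hcard]
  generalize Fintype.card (Equiv.Perm (Fin E.card)) = M at hreach ⊢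
  rw [mul_add]
  refine Nat.add_le_add_left ?_ _
  rw [← sum_edgeAt hLE fun f => meetCount (partEdges S x) f * meetCount S f, Finset.mul_sum,
    Finset.mul_sum]
  refine Finset.sum_le_sum fun j hj => ?_
  rw [← Finset.mul_sum]
  refine (Nat.mul_le_mul_left _ (hreach j (Finset.mem_filter.1 hj).2)).trans (le_of_eq ?_)
  ring

end Oracle

section Sampling

variable {V : Type*} [Fintype V] [DecidableEq V]

omit [Fintype V] [DecidableEq V] in
lemma bwE_nonneg {p : ℝ} (hp : 0 ≤ p) (hp1 : p ≤ 1) (E S : Finset (Sym2 V)) : 0 ≤ bwE p E S :=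
  mul_nonneg (pow_nonneg hp _) (pow_nonneg (sub_nonneg.2 hp1) _)

omit [DecidableEq V] in
lemma bwX_nonneg {q : ℝ} (hq : 0 ≤ q) (hq1 : q ≤ 1) (x : V → Bool) : 0 ≤ bwX q x :=
  mul_nonneg (pow_nonneg hq _) (pow_nonneg (sub_nonneg.2 hq1) _)

omit [Fintype V] in
/-- The probability that a Bernoulli sample of `E` contains `A`. -/
lemma sum_bwE_superset (p : ℝ) {E A : Finset (Sym2 V)} (hA : A ⊆ E) :
    ∑ S ∈ E.powerset, bwE p E S * (if A ⊆ S then 1 else 0) = p ^ A.card := by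
  have h := Finset.prod_add (fun _ : Sym2 V => p) (fun e => if e ∈ A then 0 else 1 - p) E
  have hl : ∏ e ∈ E, (p + if e ∈ A then 0 else 1 - p) = p ^ A.card := by
    have : ∀ e ∈ E, (p + if e ∈ A then 0 else 1 - p) = if e ∈ A then p else 1 := by
      intro e _
      split_ifs <;> ring
    rw [Finset.prod_congr rfl this, Finset.prod_ite_mem, Finset.inter_eq_right.2 hA,
      Finset.prod_const]
  rw [← hl, h]
  refine Finset.sum_congr rfl fun S hS => ?_
  have hSE := Finset.mem_powerset.1 hS
  rw [bwE, Finset.prod_const, mul_assoc]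
  congr 1
  by_cases hAS : A ⊆ S
  · have : ∀ e ∈ E \ S, (if e ∈ A then 0 else 1 - p) = 1 - p := fun e he =>
      if_neg fun h => (Finset.mem_sdiff.1 he).2 (hAS h)
    rw [Finset.prod_congr rfl this, Finset.prod_const, Finset.card_sdiff_of_subset hSE,
      if_pos hAS, mul_one]
  · obtain ⟨e, heA, heS⟩ := Finset.not_subset.1 hAS
    rw [if_neg hAS, mul_zero, Finset.prod_eq_zero (Finset.mem_sdiff.2 ⟨hA heA, heS⟩)]
    rw [if_pos heA]

/-- The probability that the random part contains `U`. -/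
lemma sum_bwX_superset (q : ℝ) (U : Finset V) :
    ∑ x : V → Bool, bwX q x * (if ∀ v ∈ U, x v then 1 else 0) = q ^ U.card := by
  have h := Fintype.prod_sum
    (fun (v : V) (b : Bool) => if b then q else if v ∈ U then 0 else 1 - q)
  have hl : ∏ v : V, ∑ b : Bool, (if b then q else if v ∈ U then 0 else 1 - q) = q ^ U.card := by
    have : ∀ v ∈ (Finset.univ : Finset V),
        ∑ b : Bool, (if b then q else if v ∈ U then 0 else 1 - q) = if v ∈ U then q else 1 := by
      intro v _
      rw [Fintype.sum_bool]
      split_ifs <;> simp_all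
    rw [Finset.prod_congr rfl this, Finset.prod_ite_mem, Finset.univ_inter, Finset.prod_const]
  rw [← hl, h]
  refine Finset.sum_congr rfl fun x _ => ?_
  rw [Finset.prod_ite, Finset.prod_const, bwX, mul_assoc]
  congr 1
  by_cases hU : ∀ v ∈ U, x v
  · have : ∀ v ∈ Finset.univ.filter (fun v => ¬ x v = true),
        (if v ∈ U then 0 else 1 - q) = 1 - q := fun v hv =>
      if_neg fun h => (Finset.mem_filter.1 hv).2 (hU v h)
    rw [Finset.prod_congr rfl this, Finset.prod_const, if_pos hU, mul_one]
    simp only [Bool.not_eq_true]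
  · rw [if_neg hU, mul_zero]
    push Not at hU
    obtain ⟨v, hvU, hv⟩ := hU
    rw [Finset.prod_eq_zero (i := v) (Finset.mem_filter.2 ⟨Finset.mem_univ _, hv⟩)]
    rw [if_pos hvU]

omit [Fintype V] in
lemma sum_bwE (p : ℝ) (E : Finset (Sym2 V)) : ∑ S ∈ E.powerset, bwE p E S = 1 := by
  simpa using sum_bwE_superset p (Finset.empty_subset E)

lemma sum_bwX (q : ℝ) : ∑ x : V → Bool, bwX q x = 1 := by
  simpa using sum_bwX_superset q (∅ : Finset V)

omit [Fintype V] in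
/-- The expected size of a Bernoulli sample. -/
lemma sum_bwE_mul_card (p : ℝ) (E : Finset (Sym2 V)) :
    ∑ S ∈ E.powerset, bwE p E S * (S.card : ℝ) = p * E.card := by
  have h : ∀ S ∈ E.powerset, bwE p E S * (S.card : ℝ) =
      ∑ e ∈ E, bwE p E S * (if {e} ⊆ S then 1 else 0) := by
    intro S hS
    rw [← Finset.mul_sum]
    simp only [Finset.singleton_subset_iff]
    rw [Finset.sum_boole, Finset.filter_mem_eq_inter,
      Finset.inter_eq_right.2 (Finset.mem_powerset.1 hS)]
  rw [Finset.sum_congr rfl h, Finset.sum_comm,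
    Finset.sum_congr rfl fun e he => sum_bwE_superset p (Finset.singleton_subset_iff.2 he)]
  simp [mul_comm]

lemma two_le_card_ends {e : Sym2 V} (he : ¬ e.IsDiag) : 2 ≤ (ends e).card := by
  induction e with
  | _ a b =>
    have hab : a ≠ b := fun h => he (Sym2.mk_isDiag_iff.2 h)
    have h : {a, b} ⊆ ends s(a, b) := by
      intro v hv
      simpa [ends] using hv
    simpa [Finset.card_pair hab] using Finset.card_le_card h

lemma ends_injective : Function.Injective (ends : Sym2 V → Finset V) := by
  intro e f h
  refine Sym2.ext fun v => ?_
  simpa [ends] using Finset.ext_iff.1 h v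

lemma three_le_card_ends_union {e f : Sym2 V} (he : ¬ e.IsDiag) (hf : ¬ f.IsDiag) (hef : f ≠ e) :
    3 ≤ (ends e ∪ ends f).card := by
  by_contra! h
  have h1 : ends e = ends e ∪ ends f := Finset.eq_of_subset_of_card_le Finset.subset_union_left
    (by have := two_le_card_ends he; omega)
  have h2 : ends f = ends e ∪ ends f := Finset.eq_of_subset_of_card_le Finset.subset_union_right
    (by have := two_le_card_ends hf; omega)
  exact hef (ends_injective (h2.trans h1.symm))

/-- The sum counting configurations of three sampled edges, two of them inside the part. -/
lemma sum_meetCount_eq {E S : Finset (Sym2 V)} (hS : S ⊆ E) (x : V → Bool) :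
    ((∑ f ∈ partEdges S x, meetCount (partEdges S x) f * meetCount S f : ℕ) : ℝ) =
      ∑ f ∈ E, ∑ g ∈ E.filter (EdgesMeet f ·), ∑ h ∈ E.filter (EdgesMeet f ·),
        (if {f, g, h} ⊆ S then (1 : ℝ) else 0) * if ∀ v ∈ ends f ∪ ends g, x v then 1 else 0 := by
  have hends (e : Sym2 V) (v : V) : v ∈ ends e ↔ v ∈ e := by simp [ends]
  have hS' (P : Sym2 V → Prop) : S.filter P = (E.filter P).filter (· ∈ S) := by
    ext e
    simp only [Finset.mem_filter]
    exact ⟨fun h => ⟨⟨hS h.1, h.2⟩, h.1⟩, fun h => ⟨h.2, h.1.2⟩⟩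
  have hL' (P : Sym2 V → Prop) : (partEdges S x).filter P =
      (E.filter P).filter (fun e => e ∈ S ∧ ∀ v ∈ e, x v) := by
    ext e
    simp only [Finset.mem_filter, partEdges]
    exact ⟨fun h => ⟨⟨hS h.1.1, h.2⟩, h.1⟩, fun h => ⟨h.2, h.1.2⟩⟩
  have hL : partEdges S x = E.filter (fun e => e ∈ S ∧ ∀ v ∈ e, x v) := by
    ext e
    simp only [Finset.mem_filter, partEdges]
    exact ⟨fun h => ⟨hS h.1, h⟩, fun h => h.2⟩
  push_cast
  simp only [meetCount, hS', hL', Finset.natCast_card_filter]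
  rw [hL, Finset.sum_filter]
  refine Finset.sum_congr rfl fun f _ => ?_
  rw [Finset.sum_mul_sum]
  split_ifs with hf
  · refine Finset.sum_congr rfl fun g _ => Finset.sum_congr rfl fun h _ => ?_
    have e1 : ({f, g, h} ⊆ S) ↔ g ∈ S ∧ h ∈ S := by
      simp [Finset.insert_subset_iff, hf.1]
    have e2 : (∀ v ∈ ends f ∪ ends g, x v) ↔ ∀ v ∈ g, x v := by
      simp only [Finset.mem_union, hends]
      exact ⟨fun h v hv => h v (Or.inr hv), fun h v hv => hv.elim (hf.2 v) (h v)⟩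
    simp only [e1, e2, ← ite_and, mul_ite, mul_one, mul_zero]
    by_cases h1 : g ∈ S <;> by_cases h2 : h ∈ S <;> by_cases h3 : ∀ v ∈ g, x v <;>
      simp [h1, h2, h3]
  · symm
    refine Finset.sum_eq_zero fun g _ => Finset.sum_eq_zero fun h _ => ?_
    by_cases h1 : f ∈ S
    · rw [if_neg (c := ∀ v ∈ ends f ∪ ends g, x v), mul_zero]
      intro h2
      exact hf ⟨h1, fun v hv => h2 v (Finset.mem_union_left _ ((hends f v).2 hv))⟩
    · rw [if_neg, zero_mul]
      intro h2
      exact h1 (h2 (Finset.mem_insert_self _ _))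

lemma pow_card_triple_le {p q : ℝ} (hp : 0 ≤ p) (hp1 : p ≤ 1) (hq : 0 ≤ q) (hq1 : q ≤ 1)
    {f g : Sym2 V} (hf : ¬ f.IsDiag) (hg : ¬ g.IsDiag) (h : Sym2 V) :
    p ^ ({f, g, h} : Finset (Sym2 V)).card * q ^ (ends f ∪ ends g).card ≤
      p * q ^ 2 * ((if g = f then 1 else 0) + p * q) *
        ((if h = f then 1 else 0) + (if h = g then 1 else 0) + p) := by
  have hpq : 0 ≤ p * q := mul_nonneg hp hq
  have hpq2 : 0 ≤ p * q ^ 2 := mul_nonneg hp (sq_nonneg q)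
  have hl0 : 0 ≤ p ^ ({f, g, h} : Finset (Sym2 V)).card := pow_nonneg hp _
  by_cases hgf : g = f
  · subst hgf
    have hq2 : q ^ (ends g ∪ ends g).card ≤ q ^ 2 :=
      pow_le_pow_of_le_one hq hq1 (by rw [Finset.union_self]; exact two_le_card_ends hg)
    have hp2 : p ^ ({g, g, h} : Finset (Sym2 V)).card ≤ p * ((if h = g then 1 else 0) + p) := by
      split_ifs with hh
      · subst hh
        simp
        nlinarith
      · simp [Finset.card_pair (Ne.symm hh)]
        nlinarith
    rw [if_pos rfl]
    refine (mul_le_mul hp2 hq2 (pow_nonneg hq _) ?_).trans ?_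
    · split_ifs <;> positivity
    · have h0 : (0 : ℝ) ≤ if h = g then 1 else 0 := by split_ifs <;> norm_num
      have h3 := mul_nonneg hpq2 (add_nonneg h0 hp)
      have h4 := mul_nonneg hpq2 h0
      have h5 := mul_nonneg hpq (mul_nonneg hpq2 (add_nonneg h0 (add_nonneg h0 hp)))
      nlinarith
  · have hq3 : q ^ (ends f ∪ ends g).card ≤ q ^ 3 :=
      pow_le_pow_of_le_one hq hq1 (three_le_card_ends_union hf hg hgf)
    have hp3 : p ^ ({f, g, h} : Finset (Sym2 V)).card ≤
        p ^ 2 * ((if h = f then 1 else 0) + (if h = g then 1 else 0) + p) := by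
      by_cases hh : h = f ∨ h = g
      · have hc : 2 ≤ ({f, g, h} : Finset (Sym2 V)).card := by
          rw [← Finset.card_pair (Ne.symm hgf)]
          exact Finset.card_le_card (by intro z; simp; tauto)
        refine (pow_le_pow_of_le_one hp hp1 hc).trans (le_mul_of_one_le_right (sq_nonneg p) ?_)
        rcases hh with hh | hh
        · rw [if_pos hh]
          split_ifs <;> linarith
        · rw [if_pos hh]
          split_ifs <;> linarith
      · push Not at hh
        have hc : ({f, g, h} : Finset (Sym2 V)).card = 3 :=
          Finset.card_eq_three.2 ⟨f, g, h, Ne.symm hgf, hh.1.symm, hh.2.symm, rfl⟩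
        rw [hc, if_neg hh.1, if_neg hh.2]
        exact le_of_eq (by ring)
    rw [if_neg hgf]
    refine (mul_le_mul hp3 hq3 (pow_nonneg hq _) ?_).trans (le_of_eq (by ring))
    exact hl0.trans hp3

/-- The expected number of configurations of a sampled edge in the part with a second one
meeting it in the part and a third one meeting it. -/
lemma expected_sum_meetCount_le {E : Finset (Sym2 V)} {Δ : ℕ} (hE : ∀ e ∈ E, ¬ e.IsDiag)
    (hΔ : ∀ v : V, (E.filter fun e => v ∈ e).card ≤ Δ) {p q : ℝ}
    (hp : 0 ≤ p) (hp1 : p ≤ 1) (hq : 0 ≤ q) (hq1 : q ≤ 1) :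
    ∑ S ∈ E.powerset, bwE p E S * ∑ x : V → Bool, bwX q x *
      ((∑ f ∈ partEdges S x, meetCount (partEdges S x) f * meetCount S f : ℕ) : ℝ) ≤
      E.card * (p * q ^ 2 * (1 + 2 * Δ * (p * q)) * (2 + 2 * Δ * p)) := by
  have hswap : ∑ S ∈ E.powerset, bwE p E S * ∑ x : V → Bool, bwX q x *
      ((∑ f ∈ partEdges S x, meetCount (partEdges S x) f * meetCount S f : ℕ) : ℝ) =
      ∑ f ∈ E, ∑ g ∈ E.filter (EdgesMeet f ·), ∑ h ∈ E.filter (EdgesMeet f ·),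
        p ^ ({f, g, h} : Finset (Sym2 V)).card * q ^ (ends f ∪ ends g).card := by
    have h1 : ∀ S ∈ E.powerset, bwE p E S * ∑ x : V → Bool, bwX q x *
        ((∑ f ∈ partEdges S x, meetCount (partEdges S x) f * meetCount S f : ℕ) : ℝ) =
        ∑ f ∈ E, ∑ g ∈ E.filter (EdgesMeet f ·), ∑ h ∈ E.filter (EdgesMeet f ·),
          (bwE p E S * if {f, g, h} ⊆ S then 1 else 0) * q ^ (ends f ∪ ends g).card := by
      intro S hS
      simp only [sum_meetCount_eq (Finset.mem_powerset.1 hS), Finset.mul_sum]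
      rw [Finset.sum_comm]
      refine Finset.sum_congr rfl fun f _ => ?_
      rw [Finset.sum_comm]
      refine Finset.sum_congr rfl fun g _ => ?_
      rw [Finset.sum_comm]
      refine Finset.sum_congr rfl fun h _ => ?_
      rw [← sum_bwX_superset, Finset.mul_sum]
      refine Finset.sum_congr rfl fun x _ => ?_
      ring
    rw [Finset.sum_congr rfl h1, Finset.sum_comm]
    refine Finset.sum_congr rfl fun f hf => ?_
    rw [Finset.sum_comm]
    refine Finset.sum_congr rfl fun g hg => ?_
    rw [Finset.sum_comm]
    refine Finset.sum_congr rfl fun h hh => ?_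
    rw [← Finset.sum_mul, sum_bwE_superset]
    simp [Finset.insert_subset_iff, hf, (Finset.mem_filter.1 hg).1, (Finset.mem_filter.1 hh).1]
  have hmeet (f : Sym2 V) : ((E.filter (EdgesMeet f ·)).card : ℝ) ≤ 2 * Δ := by
    exact_mod_cast meetCount_le hΔ f
  have hone (A : Finset (Sym2 V)) (f : Sym2 V) : ∑ h ∈ A, (if h = f then (1 : ℝ) else 0) ≤ 1 := by
    rw [Finset.sum_ite_eq']
    split_ifs <;> norm_num
  rw [hswap, ← nsmul_eq_mul]
  refine Finset.sum_le_card_nsmul _ _ _ fun f hf => ?_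
  have hpq : 0 ≤ p * q := mul_nonneg hp hq
  have hpq2 : 0 ≤ p * q ^ 2 := mul_nonneg hp (sq_nonneg q)
  calc _ ≤ ∑ g ∈ E.filter (EdgesMeet f ·), ∑ h ∈ E.filter (EdgesMeet f ·),
        p * q ^ 2 * ((if g = f then 1 else 0) + p * q) *
        ((if h = f then 1 else 0) + (if h = g then 1 else 0) + p) :=
        Finset.sum_le_sum fun g hg => Finset.sum_le_sum fun h _ =>
          pow_card_triple_le hp hp1 hq hq1 (hE f hf) (hE g (Finset.mem_filter.1 hg).1) h
    _ ≤ ∑ g ∈ E.filter (EdgesMeet f ·),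
        p * q ^ 2 * ((if g = f then 1 else 0) + p * q) * (2 + 2 * Δ * p) := by
        refine Finset.sum_le_sum fun g _ => ?_
        rw [← Finset.mul_sum]
        refine mul_le_mul_of_nonneg_left ?_
          (mul_nonneg hpq2 (add_nonneg (by split_ifs <;> norm_num) hpq))
        rw [Finset.sum_add_distrib, Finset.sum_add_distrib, Finset.sum_const, nsmul_eq_mul]
        have := hone (E.filter (EdgesMeet f ·)) f
        have := hone (E.filter (EdgesMeet f ·)) g
        have := mul_le_mul_of_nonneg_right (hmeet f) hp
        linarith
    _ ≤ _ := by
        rw [← Finset.sum_mul, ← Finset.mul_sum]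
        refine mul_le_mul_of_nonneg_right (mul_le_mul_of_nonneg_left ?_ hpq2) (by positivity)
        rw [Finset.sum_add_distrib, Finset.sum_const, nsmul_eq_mul]
        have := hone (E.filter (EdgesMeet f ·)) f
        have := mul_le_mul_of_nonneg_right (hmeet f) hpq
        linarith

/-- The total expected number of queries of the degree oracles, over all vertices. -/
lemma expected_sum_Bqueries_le {E : Finset (Sym2 V)} {Δ : ℕ} (hE : ∀ e ∈ E, ¬ e.IsDiag)
    (hΔ : ∀ v : V, (E.filter fun e => v ∈ e).card ≤ Δ) {p q : ℝ}
    (hp : 0 ≤ p) (hp1 : p ≤ 1) (hq : 0 ≤ q) (hq1 : q ≤ 1) :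
    ∑ S ∈ E.powerset, bwE p E S * ∑ x : V → Bool, bwX q x *
      ((∑ τ : Equiv.Perm (Fin E.card), ∑ v, Bqueries E (prioOf E τ) S x v : ℕ) : ℝ) ≤
      Fintype.card (Equiv.Perm (Fin E.card)) *
        (Fintype.card V * Δ + 4 * Δ * (p * E.card) +
          8 * Δ * (E.card * (p * q ^ 2 * (1 + 2 * Δ * (p * q)) * (2 + 2 * Δ * p)))) := by
  have hpoint (S : Finset (Sym2 V)) (hS : S ⊆ E) (x : V → Bool) :
      ((∑ τ : Equiv.Perm (Fin E.card), ∑ v, Bqueries E (prioOf E τ) S x v : ℕ) : ℝ) ≤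
      Fintype.card (Equiv.Perm (Fin E.card)) * (Fintype.card V * Δ + 4 * Δ * S.card + 8 * Δ *
        ((∑ f ∈ partEdges S x, meetCount (partEdges S x) f * meetCount S f : ℕ) : ℝ)) := by
    have h1 := Finset.sum_le_sum fun (τ : Equiv.Perm (Fin E.card))
      (_ : τ ∈ (Finset.univ : Finset (Equiv.Perm (Fin E.card)))) =>
        sum_Bqueries_le (S := S) hΔ (prioOf E τ) x
    simp only [Finset.sum_add_distrib, ← Finset.mul_sum, Finset.sum_const,
      Finset.card_univ, smul_eq_mul] at h1
    have h2 := sum_card_edgeOracle_le hS x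
    generalize (∑ τ : Equiv.Perm (Fin E.card), ∑ e ∈ S,
      (edgeOracle (prioOf E τ) S x e).2.1.card) = Q at h1 h2
    generalize Fintype.card (Equiv.Perm (Fin E.card)) = M at h1 h2 ⊢
    have h3 := h1.trans (Nat.add_le_add_left
      (Nat.mul_le_mul_left Δ (Nat.mul_le_mul_left 2 h2)) _)
    refine (Nat.cast_le (α := ℝ).2 h3).trans (le_of_eq ?_)
    push_cast
    ring
  have hexp := expected_sum_meetCount_le hE hΔ hp hp1 hq hq1
  generalize Fintype.card (Equiv.Perm (Fin E.card)) = M at hpoint ⊢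
  calc _ ≤ ∑ S ∈ E.powerset, bwE p E S * ∑ x : V → Bool, bwX q x *
        (M * (Fintype.card V * Δ + 4 * Δ * S.card + 8 * Δ *
        ((∑ f ∈ partEdges S x, meetCount (partEdges S x) f * meetCount S f : ℕ) : ℝ))) :=
        Finset.sum_le_sum fun S hS => mul_le_mul_of_nonneg_left
          (Finset.sum_le_sum fun x _ => mul_le_mul_of_nonneg_left
            (hpoint S (Finset.mem_powerset.1 hS) x) (bwX_nonneg hq hq1 x)) (bwE_nonneg hp hp1 E S)
    _ = M * (Fintype.card V * Δ + 4 * Δ * (p * E.card) + 8 * Δ *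
        ∑ S ∈ E.powerset, bwE p E S * ∑ x : V → Bool, bwX q x *
        ((∑ f ∈ partEdges S x, meetCount (partEdges S x) f * meetCount S f : ℕ) : ℝ)) := by
        have hx : ∀ S ∈ E.powerset, bwE p E S * ∑ x : V → Bool, bwX q x *
            (M * (Fintype.card V * Δ + 4 * Δ * S.card + 8 * Δ *
            ((∑ f ∈ partEdges S x, meetCount (partEdges S x) f * meetCount S f : ℕ) : ℝ))) =
            M * (Fintype.card V * Δ) * bwE p E S + M * (4 * Δ) * (bwE p E S * S.card) +
            M * (8 * Δ) * (bwE p E S * ∑ x : V → Bool, bwX q x *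
            ((∑ f ∈ partEdges S x, meetCount (partEdges S x) f * meetCount S f : ℕ) : ℝ)) := by
          intro S _
          generalize hF : (fun x : V → Bool => ((∑ f ∈ partEdges S x,
            meetCount (partEdges S x) f * meetCount S f : ℕ) : ℝ)) = F
          have hF' (x : V → Bool) : ((∑ f ∈ partEdges S x,
            meetCount (partEdges S x) f * meetCount S f : ℕ) : ℝ) = F x := congrFun hF x
          simp only [hF']
          have : ∑ x : V → Bool, bwX q x *
              (M * (Fintype.card V * Δ + 4 * Δ * S.card + 8 * Δ * F x)) =
              M * (Fintype.card V * Δ + 4 * Δ * S.card) * ∑ x : V → Bool, bwX q x +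
              M * (8 * Δ) * ∑ x : V → Bool, bwX q x * F x := by
            rw [Finset.mul_sum, Finset.mul_sum, ← Finset.sum_add_distrib]
            exact Finset.sum_congr rfl fun x _ => by ring
          rw [this, sum_bwX]
          ring
        rw [Finset.sum_congr rfl hx, Finset.sum_add_distrib, Finset.sum_add_distrib,
          ← Finset.mul_sum, ← Finset.mul_sum, ← Finset.mul_sum, sum_bwE, sum_bwE_mul_card]
        ring
    _ ≤ _ := by gcongr

end Sampling

lemma card_filter_lt_mul_le {ι : Type*} (s : Finset ι) (f : ι → ℝ) (hf : ∀ i ∈ s, 0 ≤ f i)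
    (t : ℝ) : ((s.filter fun i => t < f i).card : ℝ) * t ≤ ∑ i ∈ s, f i := by
  rw [← nsmul_eq_mul]
  exact (Finset.card_nsmul_le_sum _ _ _ fun i hi => (Finset.mem_filter.1 hi).2.le).trans
    (Finset.sum_le_sum_of_subset_of_nonneg (Finset.filter_subset _ _) fun i hi _ => hf i hi)


lemma total_queries_bound {a p q n e : ℝ} (ha : 1 ≤ a) (hp0 : 0 ≤ p)
    (hpa : p * a ^ 17 = 1) (hqa : q * a ^ 2 = 1) (hn : 0 ≤ n) (he : e ≤ n * a ^ 20) :
    n * a ^ 20 + 4 * a ^ 20 * (p * e) +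
      8 * a ^ 20 * (e * (p * q ^ 2 * (1 + 2 * a ^ 20 * (p * q)) * (2 + 2 * a ^ 20 * p))) ≤
      101 * n * a ^ 23 := by
  have ha0 : 0 ≤ a := zero_le_one.trans ha
  have h1 : a ^ 20 * p = a ^ 3 := by linear_combination a ^ 3 * hpa
  have h2 : a ^ 20 * (p * q) = a := by linear_combination q * h1 + a * hqa
  have h3 : p * e ≤ n * a ^ 3 := by
    refine (mul_le_mul_of_nonneg_left he hp0).trans (le_of_eq ?_)
    linear_combination n * h1
  have ha3 : 1 ≤ a ^ 3 := one_le_pow₀ ha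
  have h4 : e * (p * q ^ 2 * (1 + 2 * a ^ 20 * (p * q)) * (2 + 2 * a ^ 20 * p)) ≤
      12 * (n * a ^ 3) := by
    calc _ = p * e * (q ^ 2 * ((1 + 2 * (a ^ 20 * (p * q))) * (2 + 2 * (a ^ 20 * p)))) := by ring
      _ = p * e * (q ^ 2 * ((1 + 2 * a) * (2 + 2 * a ^ 3))) := by rw [h1, h2]
      _ ≤ (n * a ^ 3) * (q ^ 2 * ((3 * a) * (4 * a ^ 3))) := by
          gcongr <;> linarith
      _ = 12 * (n * a ^ 3) * (q * a ^ 2) ^ 2 := by ring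
      _ = 12 * (n * a ^ 3) := by rw [hqa]; ring
  have h5 : a ^ 20 ≤ a ^ 23 := pow_le_pow_right₀ ha (by norm_num)
  have h20 : 0 ≤ a ^ 20 := by positivity
  have h6 := mul_le_mul_of_nonneg_left h5 hn
  have h7 := mul_le_mul_of_nonneg_left h3 (mul_nonneg (by norm_num : (0 : ℝ) ≤ 4) h20)
  have h8 := mul_le_mul_of_nonneg_left h4 (mul_nonneg (by norm_num : (0 : ℝ) ≤ 8) h20)
  linarith

universe u

/-- **Few bad vertices** (Claim 4.8).
There is a universal constant `C > 0` such that the following holds.  Run Algorithm 1 on an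
`n`-vertex graph `G = (V, E)` with maximum degree `Δ` (edge-sampling probability
`p = Δ^{-0.85}`, `k = Δ^{0.1}` parts).  Call a vertex `v` *bad* (with respect to `π` and
`L`) if `E_{x⃗}[B(v) ∣ π, L] > Δ^{1.4}` — the expectation being over the indicator vector
`x⃗` of `V₁`, whose coordinates are i.i.d. Bernoulli-`1/k` — and let `𝓑` be the set of bad
vertices.  Then `E_{π, L}[ |𝓑| ] ≤ C·n·Δ^{-0.25}`. -/
theorem expected_number_of_bad_vertices :
    ∃ C : ℝ, 0 < C ∧
      ∀ (V : Type u) [Fintype V] [DecidableEq V]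
        (E : Finset (Sym2 V)) (_ : ∀ e ∈ E, ¬ e.IsDiag)
        (Δ : ℕ) (_ : ∀ v : V, (E.filter fun e => v ∈ e).card ≤ Δ) (_ : 1 ≤ Δ)
        (p : ℝ) (_ : p = (Δ : ℝ) ^ (-(0.85 : ℝ)))
        (k : ℕ) (_ : (k : ℝ) = (Δ : ℝ) ^ ((0.1 : ℝ))) (_ : 0 < k),
        (∑ τ : Equiv.Perm (Fin E.card), ∑ S ∈ E.powerset,
            bwE p E S *
              ((Finset.univ.filter fun v : V =>
                  (Δ : ℝ) ^ ((1.4 : ℝ)) <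
                    ∑ x : V → Bool, bwX (1 / (k : ℝ)) x *
                      (Bqueries E (prioOf E τ) S x v : ℝ)).card : ℝ)) /
          (Fintype.card (Equiv.Perm (Fin E.card)) : ℝ) ≤
        C * Fintype.card V * (Δ : ℝ) ^ (-(0.25 : ℝ)) := by
  refine ⟨101, by norm_num, ?_⟩
  intro V _ _ E hE Δ hΔ hΔ1 p hp k hk hk0
  have hΔ1' : (1 : ℝ) ≤ Δ := by exact_mod_cast hΔ1
  have hΔ0 : (0 : ℝ) ≤ Δ := zero_le_one.trans hΔ1'
  obtain ⟨a, ha⟩ : ∃ a : ℝ, a = (Δ : ℝ) ^ (0.05 : ℝ) := ⟨_, rfl⟩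
  have ha1 : 1 ≤ a := ha ▸ Real.one_le_rpow hΔ1' (by norm_num)
  have ha0 : 0 < a := zero_lt_one.trans_le ha1
  have hpow (m : ℕ) (r : ℝ) (hr : 0.05 * m = r) : (Δ : ℝ) ^ r = a ^ m := by
    rw [ha, ← Real.rpow_natCast, ← Real.rpow_mul hΔ0, hr]
  have hΔa : (Δ : ℝ) = a ^ 20 := by
    rw [← hpow 20 1 (by norm_num), Real.rpow_one]
  have hka : (k : ℝ) = a ^ 2 := hk.trans (hpow 2 _ (by norm_num))
  have hpa' : p = (a ^ 17)⁻¹ := by rw [hp, Real.rpow_neg hΔ0, hpow 17 _ (by norm_num)]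
  have hta : (Δ : ℝ) ^ (1.4 : ℝ) = a ^ 28 := hpow 28 _ (by norm_num)
  have hra : (Δ : ℝ) ^ (-(0.25 : ℝ)) = (a ^ 5)⁻¹ := by
    rw [Real.rpow_neg hΔ0, hpow 5 _ (by norm_num)]
  have hp0 : 0 ≤ p := by rw [hpa']; positivity
  have hp1 : p ≤ 1 := by rw [hpa']; exact inv_le_one_of_one_le₀ (one_le_pow₀ ha1)
  have hpa : p * a ^ 17 = 1 := by rw [hpa']; exact inv_mul_cancel₀ (by positivity)
  obtain ⟨q, hq⟩ : ∃ q : ℝ, q = 1 / (k : ℝ) := ⟨_, rfl⟩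
  have hq' : q = (a ^ 2)⁻¹ := by rw [hq, hka, one_div]
  have hq0 : 0 ≤ q := by rw [hq']; positivity
  have hq1 : q ≤ 1 := by rw [hq']; exact inv_le_one_of_one_le₀ (one_le_pow₀ ha1)
  have hqa : q * a ^ 2 = 1 := by rw [hq']; exact inv_mul_cancel₀ (by positivity)
  rw [← hq, hta, hra]
  have hN : (0 : ℝ) < Fintype.card (Equiv.Perm (Fin E.card)) := by exact_mod_cast Fintype.card_pos
  have htotal := expected_sum_Bqueries_le hE hΔ hp0 hp1 hq0 hq1
  have hbound := total_queries_bound (n := Fintype.card V) (e := E.card) ha1 hp0 hpa hqa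
    (Nat.cast_nonneg _) (by rw [← hΔa]; exact_mod_cast card_edges_le hΔ)
  rw [← hΔa] at hbound
  have hmarkov : (∑ τ : Equiv.Perm (Fin E.card), ∑ S ∈ E.powerset, bwE p E S *
      ((Finset.univ.filter fun v : V => a ^ 28 <
        ∑ x : V → Bool, bwX q x * (Bqueries E (prioOf E τ) S x v : ℝ)).card : ℝ)) * a ^ 28 ≤
      ∑ S ∈ E.powerset, bwE p E S * ∑ x : V → Bool, bwX q x *
      ((∑ τ : Equiv.Perm (Fin E.card), ∑ v, Bqueries E (prioOf E τ) S x v : ℕ) : ℝ) := by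
    rw [Finset.sum_comm, Finset.sum_mul]
    refine Finset.sum_le_sum fun S _ => ?_
    rw [← Finset.mul_sum, mul_assoc]
    refine mul_le_mul_of_nonneg_left ?_ (bwE_nonneg hp0 hp1 E S)
    rw [Finset.sum_mul]
    refine (Finset.sum_le_sum fun τ _ => card_filter_lt_mul_le _ _ (fun v _ =>
      Finset.sum_nonneg fun x _ => mul_nonneg (bwX_nonneg hq0 hq1 x) (Nat.cast_nonneg _)) _).trans
      (le_of_eq ?_)
    push_cast
    simp only [Finset.mul_sum]
    rw [Finset.sum_congr rfl fun τ _ => Finset.sum_comm, Finset.sum_comm]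
  rw [div_le_iff₀ hN]
  generalize (Fintype.card (Equiv.Perm (Fin E.card)) : ℝ) = N at hN htotal ⊢
  refine le_of_mul_le_mul_right ?_ (pow_pos ha0 28)
  refine (hmarkov.trans htotal).trans ((mul_le_mul_of_nonneg_left hbound hN.le).trans
    (le_of_eq ?_))
  field_simp
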